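/- Corollary 1 (tightening). Under the sample selection model with Assumptions 1, 3, 4 (tail smoothness) and 5 (symmetry), integrable Y₀*, Y₁*, continuous strictly increasing conditional CDF F₁ of Y given {D=1, S=1} with density f¹, and the positivity conditions, the symmetry bounds are contained in the stochastic-monotonicity bounds: [∇̲ˢ, ∇̄ˢ] ⊆ [∇̲, ∇̄], i.e. ∇̲ := E[Y | D=1, S=1, Y ≤ y¹_{ϑq₀}] − E[Y | D=0, S=1] ≤ ∇̲ˢ := y¹_{ϑq₀/2} − E[Y | D=0, S=1] and ∇̄ˢ := y¹_{1−ϑq₀/2} − E[Y | D=0, S=1] ≤ ∇̄ := E[Y | D=1, S=1, Y ≥ y¹_{1−ϑq₀}] − E[Y | D=0, S=1]. -/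

import Mathlib

open MeasureTheory ProbabilityTheory Set

noncomputable section

variable {Ω : Type*} [MeasurableSpace Ω]

/-- Probability of an event as a real number. -/
def pr (μ : Measure Ω) (A : Set Ω) : ℝ := (μ A).toReal

/-- Conditional probability `P(B | A)`. -/
def cpr (μ : Measure Ω) (A B : Set Ω) : ℝ := pr μ (A ∩ B) / pr μ A

/-- Conditional expectation of `X` given the event `A`. -/
def cexp (μ : Measure Ω) (X : Ω → ℝ) (A : Set Ω) : ℝ := (∫ ω in A, X ω ∂μ) / pr μ A

/-- key lemma, generic case -/
lemma key_lt (ν : Measure ℝ) [IsProbabilityMeasure ν] [NullSingletonClass ν] (hi : Integrable (fun x : ℝ => x) ν)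
    (m c : ℝ) (hmc : m ≤ c)
    (hle : ∀ s : Set ℝ, MeasurableSet s → s ⊆ Ici m → ν ((fun x => 2 * m - x) ⁻¹' s) ≤ ν s)
    (hmass : ν.real (Iic c) = 2 * ν.real (Iic m)) :
    ∫ x in Iic c, x ∂ν ≤ m * ν.real (Iic c) := by
  have hsplit : Iic c = Iic m ∪ Ioc m c := (Iic_union_Ioc_eq_Iic hmc).symm
  have hdisj : Disjoint (Iic m) (Ioc m c) := by
    rw [Set.disjoint_left]; intro x hx hx'; exact absurd hx'.1 (not_lt.mpr hx)
  have hm2 : ν.real (Iic c) = ν.real (Iic m) + ν.real (Ioc m c) := by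
    rw [hsplit, measureReal_union hdisj measurableSet_Ioc]
  have hI : ∫ x in Iic c, x ∂ν = ∫ x in Iic m, x ∂ν + ∫ x in Ioc m c, x ∂ν := by
    rw [hsplit, setIntegral_union hdisj measurableSet_Ioc hi.integrableOn hi.integrableOn]
  set h := c - m with hh
  have hic : ∀ k : ℝ, Integrable (fun _ : ℝ => k) ν := fun k => integrable_const k
  -- measure comparison
  have hmeas : Measurable (fun x : ℝ => 2 * m - x) := by fun_prop
  have hcmp : (ν.restrict (Icc (m - h) m)).map (fun x => 2 * m - x) ≤ ν.restrict (Icc m c) := by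
    refine Measure.le_iff.mpr fun s hs => ?_
    rw [Measure.map_apply hmeas hs, Measure.restrict_apply (hmeas hs), Measure.restrict_apply hs]
    refine le_trans (measure_mono ?_) (hle (s ∩ Icc m c) (hs.inter measurableSet_Icc)
      (fun x hx => hx.2.1))
    rintro x ⟨hx, hx1, hx2⟩
    refine ⟨hx, ?_, ?_⟩ <;> simp only [hh] at * <;> linarith
  have h1 : ∫ x in Icc (m - h) m, (c - (2 * m - x)) ∂ν ≤ ∫ x in Icc m c, (c - x) ∂ν := by
    have := integral_mono_measure (f := fun x => c - x) hcmp
      (by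
        rw [Filter.EventuallyLE, ae_restrict_iff' measurableSet_Icc]
        exact Filter.Eventually.of_forall fun x hx => by simpa using hx.2)
      (((hic c).sub hi).integrableOn)
    rwa [integral_map hmeas.aemeasurable (by fun_prop)] at this
  have h2 : ∫ x in Iic m, (c - (2 * m - x)) ∂ν ≤ ∫ x in Icc (m - h) m, (c - (2 * m - x)) ∂ν := by
    rw [← integral_indicator measurableSet_Iic, ← integral_indicator measurableSet_Icc]
    have hg : Integrable (fun x => c - (2 * m - x)) ν := (hic c).sub ((hic _).sub hi)
    refine integral_mono (hg.indicator measurableSet_Iic) (hg.indicator measurableSet_Icc) ?_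
    intro x
    by_cases hx : x ≤ m
    · by_cases hx' : m - h ≤ x
      · simp [indicator, hx, hx']
      · have : c - (2 * m - x) ≤ 0 := by simp only [hh] at *; linarith
        simpa [indicator, hx, hx'] using this
    · simp [indicator, hx]
  have h3 := h2.trans h1
  rw [integral_Icc_eq_integral_Ioc] at h3
  have e1 : ∫ x in Iic m, (c - (2 * m - x)) ∂ν = (c - 2 * m) * ν.real (Iic m) + ∫ x in Iic m, x ∂ν := by
    have : (fun x : ℝ => c - (2 * m - x)) = fun x => (c - 2 * m) + x := by ext; ring
    rw [this, integral_add (hic _).integrableOn hi.integrableOn]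
    simp [mul_comm]
  have e2 : ∫ x in Ioc m c, (c - x) ∂ν = c * ν.real (Ioc m c) - ∫ x in Ioc m c, x ∂ν := by
    rw [integral_sub (hic _).integrableOn hi.integrableOn]
    simp [mul_comm]
  rw [e1, e2] at h3
  rw [hI, hmass]
  have : ν.real (Ioc m c) = ν.real (Iic m) := by linarith
  rw [this] at h3
  linarith

/-- key lemma, symmetric case -/
lemma key_sym (ν : Measure ℝ) [IsProbabilityMeasure ν] (hi : Integrable (fun x : ℝ => x) ν)
    (m c : ℝ) (hsym : ν.map (fun x => 2 * m - x) = ν) :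
    ∫ x in Iic c, x ∂ν ≤ m * ν.real (Iic c) := by
  have hic : ∀ k : ℝ, Integrable (fun _ : ℝ => k) ν := fun k => integrable_const k
  have hmean : ∫ x, x ∂ν = m := by
    have h1 : ∫ x, x ∂ν = ∫ x, (2 * m - x) ∂ν := by
      conv_lhs => rw [← hsym]
      rw [integral_map (by fun_prop) (by fun_prop)]
    rw [integral_sub (hic _) hi] at h1
    simp at h1
    linarith
  have hk : m * ν.real (Iic c) = ∫ x in Iic c, m ∂ν := by simp [mul_comm]
  rcases le_total c m with hcm | hcm
  · rw [hk]
    exact setIntegral_mono_on hi.integrableOn (hic m).integrableOn measurableSet_Iic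
      fun x hx => le_trans hx hcm
  · have h1 := integral_add_compl (measurableSet_Iic (a := c)) hi
    have h2 : ∫ x in (Iic c)ᶜ, m ∂ν ≤ ∫ x in (Iic c)ᶜ, x ∂ν :=
      setIntegral_mono_on (hic m).integrableOn hi.integrableOn measurableSet_Iic.compl
        fun x hx => by simp at hx; linarith
    have h3 := integral_add_compl (measurableSet_Iic (a := c)) (hic m)
    simp only [integral_const, probReal_univ, one_smul] at h3
    rw [hk]
    simp only [integral_const] at *
    linarith

/-- reflection of a density measure -/
lemma refl_apply (g : ℝ → ℝ) (m : ℝ) (s : Set ℝ) (hs : MeasurableSet s) :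
    (volume.withDensity fun x => ENNReal.ofReal (g x)) ((fun x => 2 * m - x) ⁻¹' s)
      = ∫⁻ x in s, ENNReal.ofReal (g (2 * m - x)) := by
  have hmeas : Measurable (fun x : ℝ => 2 * m - x) := by fun_prop
  rw [withDensity_apply _ (hmeas hs)]
  have hmp : MeasurePreserving (MeasurableEquiv.subLeft (2 * m)) (volume : Measure ℝ) volume :=
    Measure.measurePreserving_sub_left volume (2 * m)
  have := hmp.restrict_preimage (s := s) hs
  have h2 := this.lintegral_comp_emb (MeasurableEquiv.measurableEmbedding _)
    (fun x => ENNReal.ofReal (g (2 * m - x)))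
  rw [← h2]
  have e : ∀ x : ℝ, 2 * m - (MeasurableEquiv.subLeft (2 * m)) x = x := by
    intro x
    change 2 * m - (2 * m - x) = x
    ring
  simp only [e]
  rfl

lemma quantile_facts (ν : Measure ℝ) [IsProbabilityMeasure ν] (F1 yq : ℝ → ℝ)
    (hF : ∀ t, F1 t = ν.real (Iic t)) (hyq : ∀ r, yq r = sInf {t : ℝ | r ≤ F1 t})
    (hc : Continuous F1) (hm : StrictMono F1) (r : ℝ) (h0 : 0 < r) (h1 : r < 1) :
    ν.real (Iic (yq r)) = r := by
  have hF' : F1 = cdf ν := by ext t; rw [hF, cdf_eq_real]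
  have ht : Filter.Tendsto F1 Filter.atTop (nhds 1) := hF' ▸ tendsto_cdf_atTop ν
  have hb : Filter.Tendsto F1 Filter.atBot (nhds 0) := hF' ▸ tendsto_cdf_atBot ν
  obtain ⟨a, ha⟩ := (hb.eventually (gt_mem_nhds h0)).exists
  obtain ⟨b, hb⟩ := (ht.eventually (lt_mem_nhds h1)).exists
  obtain ⟨t, rfl⟩ := mem_range_of_exists_le_of_exists_ge hc ⟨a, ha.le⟩ ⟨b, hb.le⟩
  have : {s : ℝ | F1 t ≤ F1 s} = Ici t := by ext s; simp [hm.le_iff_le]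
  rw [hyq, this, csInf_Ici, hF]

/-- everything on the real line -/
lemma real_line (ν : Measure ℝ) [IsProbabilityMeasure ν] (hi : Integrable (fun x : ℝ => x) ν)
    (F1 yq f1 : ℝ → ℝ)
    (hF : ∀ t, F1 t = ν.real (Iic t)) (hyq : ∀ r, yq r = sInf {t : ℝ | r ≤ F1 t})
    (hc : Continuous F1) (hm : StrictMono F1)
    (hf1 : ν = volume.withDensity fun x => ENNReal.ofReal (f1 x))
    (p : ℝ) (hp0 : 0 < p) (hp1 : p ≤ 1)
    (htailL : ∀ a : ℝ, 0 ≤ a → f1 (yq (p / 2) - a) ≤ f1 (yq (p / 2) + a))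
    (htailU : ∀ a : ℝ, 0 ≤ a → f1 (yq (1 - p / 2) + a) ≤ f1 (yq (1 - p / 2) - a)) :
    ∫ x in Iic (yq p), x ∂ν ≤ yq (p / 2) * ν.real (Iic (yq p)) ∧
    yq (1 - p / 2) * ν.real (Ici (yq (1 - p))) ≤ ∫ x in Ici (yq (1 - p)), x ∂ν := by
  have hna : NullSingletonClass ν := by
    refine ⟨fun x => ?_⟩
    rw [hf1, withDensity_apply _ (measurableSet_singleton x)]
    simp
  set ν' := ν.map (fun x => -x) with hν'
  have hneg : Measurable (fun x : ℝ => -x) := measurable_neg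
  have : IsProbabilityMeasure ν' := Measure.isProbabilityMeasure_map hneg.aemeasurable
  have hi' : Integrable (fun x : ℝ => x) ν' := by
    rw [hν', integrable_map_measure (by fun_prop) hneg.aemeasurable]
    exact hi.neg
  have hpre : ∀ t : ℝ, (fun x : ℝ => -x) ⁻¹' (Iic (-t)) = Ici t := by intro t; ext; simp
  have hreal' : ∀ t, ν'.real (Iic (-t)) = ν.real (Ici t) := by
    intro t
    rw [measureReal_def, hν', Measure.map_apply hneg measurableSet_Iic, hpre, measureReal_def]
  have hIci : ∀ t, ν.real (Ici t) = 1 - ν.real (Iic t) := by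
    intro t
    rw [← compl_Iio, probReal_compl_eq_one_sub measurableSet_Iio, measureReal_congr Iio_ae_eq_Iic]
  have hint' : ∀ t, ∫ x in Iic (-t), x ∂ν' = - ∫ x in Ici t, x ∂ν := by
    intro t
    rw [hν', setIntegral_map measurableSet_Iic (by fun_prop) hneg.aemeasurable, hpre, integral_neg]
  have hna' : NullSingletonClass ν' := by
    refine ⟨fun x => ?_⟩
    rw [hν', Measure.map_apply hneg (measurableSet_singleton x)]
    have : (fun x : ℝ => -x) ⁻¹' {x} = {-x} := by ext y; simp [neg_eq_iff_eq_neg]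
    rw [this]; simp
  have hmono : StrictMono (fun t => ν.real (Iic t)) := by
    have : (fun t => ν.real (Iic t)) = F1 := by ext t; rw [hF]
    rwa [this]
  rcases hp1.lt_or_eq with hp | rfl
  · have q1 := quantile_facts ν F1 yq hF hyq hc hm p hp0 hp
    have q2 := quantile_facts ν F1 yq hF hyq hc hm (p / 2) (by linarith) (by linarith)
    have q3 := quantile_facts ν F1 yq hF hyq hc hm (1 - p) (by linarith) (by linarith)
    have q4 := quantile_facts ν F1 yq hF hyq hc hm (1 - p / 2) (by linarith) (by linarith)
    constructor
    · refine key_lt ν hi _ _ ?_ ?_ (by rw [q1, q2]; ring)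
      · exact hmono.le_iff_le.mp (by simp only [q1, q2]; linarith)
      · intro s hs hsub
        rw [hf1, refl_apply _ _ _ hs, withDensity_apply _ hs]
        refine setLIntegral_mono' hs fun x hx => ENNReal.ofReal_le_ofReal ?_
        have := htailL (x - yq (p / 2)) (by have := hsub hx; simp at this; linarith)
        convert this using 2 <;> ring
    · have := key_lt ν' hi' (-yq (1 - p / 2)) (-yq (1 - p)) ?_ ?_
        (by rw [hreal', hreal', hIci, hIci, q3, q4]; ring)
      · rw [hint', hreal'] at this; linarith
      · exact neg_le_neg (hmono.le_iff_le.mp (by simp only [q3, q4]; linarith))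
      · intro s hs hsub
        have hr : Measurable (fun x : ℝ => 2 * -yq (1 - p / 2) - x) := by fun_prop
        rw [hν', Measure.map_apply hneg (hr hs), Measure.map_apply hneg hs]
        have e : (fun x : ℝ => -x) ⁻¹' ((fun x : ℝ => 2 * -yq (1 - p / 2) - x) ⁻¹' s)
            = (fun x : ℝ => 2 * yq (1 - p / 2) - x) ⁻¹' ((fun x : ℝ => -x) ⁻¹' s) := by
          ext x; simp only [mem_preimage]; ring_nf
        rw [e, hf1, refl_apply _ _ _ (hneg hs), withDensity_apply _ (hneg hs)]
        refine setLIntegral_mono' (hneg hs) fun x hx => ENNReal.ofReal_le_ofReal ?_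
        have := htailU (yq (1 - p / 2) - x) (by have := hsub hx; simp at this; linarith)
        convert this using 2 <;> ring
  · have e : (1 : ℝ) - 1 / 2 = 1 / 2 := by norm_num
    rw [e] at *
    have hs : ν.map (fun x => 2 * yq (1 / 2) - x) = ν := by
      ext s hs
      rw [Measure.map_apply (by fun_prop) hs, hf1, refl_apply _ _ _ hs, withDensity_apply _ hs]
      refine setLIntegral_congr_fun hs fun x _ => ?_
      have : f1 (2 * yq (1 / 2) - x) = f1 x := by
        rcases le_total (yq (1 / 2)) x with h | h
        · have h1 := htailL (x - yq (1 / 2)) (by linarith)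
          have h2 := htailU (x - yq (1 / 2)) (by linarith)
          ring_nf at h1 h2 ⊢
          linarith
        · have h1 := htailL (yq (1 / 2) - x) (by linarith)
          have h2 := htailU (yq (1 / 2) - x) (by linarith)
          ring_nf at h1 h2 ⊢
          linarith
      simp only [this]
    refine ⟨key_sym ν hi _ _ hs, ?_⟩
    have := key_sym ν' hi' (-yq (1 / 2)) (-yq (1 - 1)) ?_
    · rw [hint', hreal'] at this; linarith
    · conv_rhs => rw [hν', ← hs]
      rw [hν', Measure.map_map (by fun_prop) hneg, Measure.map_map hneg (by fun_prop)]
      congr 1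
      ext x
      simp only [Function.comp]
      ring

/-- **Corollary 1 (tightening).** Under Assumptions 1, 3, 4 (tail smoothness) and 5
(symmetry), the symmetry bounds `[∇̲ˢ, ∇̄ˢ]` are contained in the
stochastic-monotonicity bounds `[∇̲, ∇̄]`. -/
theorem symmetry_bounds_tighter
    (μ : Measure Ω) [IsProbabilityMeasure μ]
    (Y1 Y0 S1 S0 D S Y : Ω → ℝ)
    (hY1m : Measurable Y1) (hY0m : Measurable Y0)
    (hS1m : Measurable S1) (hS0m : Measurable S0) (hDm : Measurable D)
    (hS1v : ∀ ω, S1 ω = 0 ∨ S1 ω = 1) (hS0v : ∀ ω, S0 ω = 0 ∨ S0 ω = 1)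
    (hDv : ∀ ω, D ω = 0 ∨ D ω = 1)
    (hS : ∀ ω, S ω = S1 ω * D ω + S0 ω * (1 - D ω))
    (hY : ∀ ω, Y ω = S ω * (Y1 ω * D ω + Y0 ω * (1 - D ω)))
    (hY1i : Integrable Y1 μ) (hY0i : Integrable Y0 μ)
    -- Assumption 1 (independent assignment)
    (hIndep : IndepFun (fun ω => (Y1 ω, Y0 ω, S1 ω, S0 ω)) D μ)
    -- Assumption 3 (stochastic monotonicity)
    (ϑL : ℝ) (hϑL : ϑL ∈ Set.Ioc (0 : ℝ) 1)
    (hSM1 : ϑL ≤ cpr μ {ω | S0 ω = 1} {ω | S1 ω = 1})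
    (hSM2 : IndepFun (fun ω => (Y1 ω, Y0 ω)) S1 (μ[|{ω | S0 ω = 1}]))
    -- identified quantities
    (α0 q0 ϑF ϑ τ : ℝ) (F1 : ℝ → ℝ) (yq : ℝ → ℝ)
    (hα0 : α0 = cpr μ {ω | D ω = 0} {ω | S ω = 1})
    (hq0 : q0 = cpr μ {ω | D ω = 0} {ω | S ω = 1} / cpr μ {ω | D ω = 1} {ω | S ω = 1})
    (hϑF : ϑF = 1 + 1 / q0 - 1 / α0)
    (hϑ : ϑ = max ϑL ϑF)
    (hF1 : ∀ t, F1 t = cpr μ {ω | D ω = 1 ∧ S ω = 1} {ω | Y ω ≤ t})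
    (hyq : ∀ r, yq r = sInf {t : ℝ | r ≤ F1 t})
    (hF1cont : Continuous F1) (hF1mono : StrictMono F1)
    (hτ : τ = cexp μ (fun ω => Y1 ω - Y0 ω) {ω | S0 ω = 1 ∧ S1 ω = 1})
    -- positivity conditions
    (hD1 : 0 < pr μ {ω | D ω = 1}) (hD1' : pr μ {ω | D ω = 1} < 1)
    (hSD0 : 0 < pr μ {ω | S ω = 1 ∧ D ω = 0})
    (hSD1 : 0 < pr μ {ω | S ω = 1 ∧ D ω = 1})
    (hAT : 0 < pr μ {ω | S0 ω = 1 ∧ S1 ω = 1}) -- Assumption 5 (symmetry of the conditional density of Y1* for always-takers)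
    (hsym : ∃ (f : ℝ → ℝ) (mc : ℝ),
      (Measure.map Y1 (μ[|{ω | S0 ω = 1 ∧ S1 ω = 1}])
          = volume.withDensity fun x => ENNReal.ofReal (f x)) ∧
        ∀ x : ℝ, f (mc + x) = f (mc - x))
    -- conditional density of Y given {D=1, S=1}
    (f1 : ℝ → ℝ)
    (hf1 : Measure.map Y (μ[|{ω | D ω = 1 ∧ S ω = 1}])
        = volume.withDensity fun x => ENNReal.ofReal (f1 x))
    -- Assumption 4 (tail smoothness)
    (htailL : ∀ a : ℝ, 0 ≤ a → f1 (yq (ϑ * q0 / 2) - a) ≤ f1 (yq (ϑ * q0 / 2) + a))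
    (htailU : ∀ a : ℝ, 0 ≤ a → f1 (yq (1 - ϑ * q0 / 2) + a) ≤ f1 (yq (1 - ϑ * q0 / 2) - a)) :
    cexp μ Y {ω | D ω = 1 ∧ S ω = 1 ∧ Y ω ≤ yq (ϑ * q0)}
        - cexp μ Y {ω | D ω = 0 ∧ S ω = 1}
      ≤ yq (ϑ * q0 / 2) - cexp μ Y {ω | D ω = 0 ∧ S ω = 1} ∧
    yq (1 - ϑ * q0 / 2) - cexp μ Y {ω | D ω = 0 ∧ S ω = 1}
      ≤ cexp μ Y {ω | D ω = 1 ∧ S ω = 1 ∧ yq (1 - ϑ * q0) ≤ Y ω}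
        - cexp μ Y {ω | D ω = 0 ∧ S ω = 1} := by
  set A : Set Ω := {ω | D ω = 1 ∧ S ω = 1} with hA
  have hSm : Measurable S := by
    have : S = fun ω => S1 ω * D ω + S0 ω * (1 - D ω) := funext hS
    rw [this]; fun_prop
  have hYm : Measurable Y := by
    have : Y = fun ω => S ω * (Y1 ω * D ω + Y0 ω * (1 - D ω)) := funext hY
    rw [this]; fun_prop
  have hev : ∀ (X : Ω → ℝ) (a : ℝ), Measurable X → MeasurableSet {ω | X ω = a} :=
    fun X a hX => hX (measurableSet_singleton a)
  have hAm : MeasurableSet A := (hev D 1 hDm).inter (hev S 1 hSm)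
  have hYi : Integrable Y μ := by
    refine (hY1i.norm.add hY0i.norm).mono hYm.aestronglyMeasurable
      (Filter.Eventually.of_forall fun ω => ?_)
    have n1 := norm_nonneg (Y1 ω)
    have n0 := norm_nonneg (Y0 ω)
    have : ‖‖Y1 ω‖ + ‖Y0 ω‖‖ = ‖Y1 ω‖ + ‖Y0 ω‖ := by
      rw [Real.norm_eq_abs, abs_of_nonneg (by linarith)]
    simp only [Pi.add_apply]
    rw [this, hY, hS]
    rcases hDv ω with h | h <;> rcases hS1v ω with h1 | h1 <;> rcases hS0v ω with h0 | h0 <;>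
      simp [h, h1, h0] <;> positivity
  have hApos : 0 < pr μ A := by
    have : A = {ω | S ω = 1 ∧ D ω = 1} := by ext; simp [hA, and_comm]
    rw [this]; exact hSD1
  have hA0 : μ A ≠ 0 := fun h => by simp [pr, h] at hApos
  have : IsProbabilityMeasure (μ[|A]) := cond_isProbabilityMeasure hA0
  set ν := Measure.map Y (μ[|A]) with hν
  have : IsProbabilityMeasure ν := Measure.isProbabilityMeasure_map hYm.aemeasurable
  have hYci : Integrable Y (μ[|A]) := by
    rw [ProbabilityTheory.cond]
    exact hYi.integrableOn.smul_measure (ENNReal.inv_ne_top.mpr hA0)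
  have hi : Integrable (fun x : ℝ => x) ν := by
    rw [hν, integrable_map_measure (by fun_prop) hYm.aemeasurable]
    exact hYci
  have hνr : ∀ s : Set ℝ, MeasurableSet s → ν.real s = pr μ (A ∩ Y ⁻¹' s) / pr μ A := by
    intro s hs
    rw [measureReal_def, hν, Measure.map_apply hYm hs, cond_apply hAm, ENNReal.toReal_mul,
      ENNReal.toReal_inv, pr, pr, div_eq_inv_mul]
  have hνi : ∀ s : Set ℝ, MeasurableSet s →
      ∫ x in s, x ∂ν = (∫ ω in A ∩ Y ⁻¹' s, Y ω ∂μ) / pr μ A := by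
    intro s hs
    rw [hν, setIntegral_map hs (by fun_prop) hYm.aemeasurable, ProbabilityTheory.cond, Measure.restrict_smul,
      integral_smul_measure, Measure.restrict_restrict (hYm hs), inter_comm, ENNReal.toReal_inv,
      smul_eq_mul, pr, div_eq_inv_mul]
  have hce : ∀ s : Set ℝ, MeasurableSet s →
      cexp μ Y (A ∩ Y ⁻¹' s) = (∫ x in s, x ∂ν) / ν.real s := by
    intro s hs
    rw [hνi s hs, hνr s hs, cexp, div_div_div_cancel_right₀ hApos.ne']
  have hF : ∀ t, F1 t = ν.real (Iic t) := by
    intro t; rw [hF1, hνr _ measurableSet_Iic]; rfl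
  -- p = ϑ q0 ∈ (0,1]
  have hprle : ∀ s, pr μ s ≤ 1 := fun s => measureReal_le_one
  have hprnn : ∀ s, 0 ≤ pr μ s := fun s => measureReal_nonneg
  have hprm : ∀ s t : Set Ω, s ⊆ t → pr μ s ≤ pr μ t := fun s t h => measureReal_mono h
  have hind : ∀ (X : Ω → ℝ) (k : ℝ) (g : ℝ × ℝ × ℝ × ℝ → ℝ), Measurable g →
      (∀ ω, X ω = g (Y1 ω, Y0 ω, S1 ω, S0 ω)) →
      pr μ ({ω | D ω = k} ∩ {ω | X ω = 1}) = pr μ {ω | D ω = k} * pr μ {ω | X ω = 1} := by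
    intro X k g hg hX
    have h := hIndep.measure_inter_preimage_eq_mul (g ⁻¹' {1}) {k}
      (hg (measurableSet_singleton 1)) (measurableSet_singleton k)
    have e1 : {ω | X ω = 1} = (fun ω => (Y1 ω, Y0 ω, S1 ω, S0 ω)) ⁻¹' (g ⁻¹' {1}) := by
      ext ω; simp [hX]
    have e2 : {ω | D ω = k} = D ⁻¹' {k} := rfl
    rw [e1, e2, inter_comm, pr, h, ENNReal.toReal_mul, mul_comm, pr, pr]
  have hi1 := hind S1 1 (fun z => z.2.2.1) (by fun_prop) (fun _ => rfl)
  have hi0 := hind S0 0 (fun z => z.2.2.2) (by fun_prop) (fun _ => rfl)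
  have es1 : {ω | D ω = 1} ∩ {ω | S ω = 1} = {ω | D ω = 1} ∩ {ω | S1 ω = 1} := by
    ext ω; simp only [mem_inter_iff, mem_ofPred_eq, hS]
    exact and_congr_right fun h => by simp [h]
  have es0 : {ω | D ω = 0} ∩ {ω | S ω = 1} = {ω | D ω = 0} ∩ {ω | S0 ω = 1} := by
    ext ω; simp only [mem_inter_iff, mem_ofPred_eq, hS]
    exact and_congr_right fun h => by simp [h]
  have hD0 : 0 < pr μ {ω | D ω = 0} := lt_of_lt_of_le hSD0 (hprm _ _ fun ω h => h.2)
  have hc1 : cpr μ {ω | D ω = 1} {ω | S ω = 1} = pr μ {ω | S1 ω = 1} := by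
    rw [cpr, es1, hi1, mul_div_cancel_left₀ _ hD1.ne']
  have hc0 : cpr μ {ω | D ω = 0} {ω | S ω = 1} = pr μ {ω | S0 ω = 1} := by
    rw [cpr, es0, hi0, mul_div_cancel_left₀ _ hD0.ne']
  set a := pr μ {ω | S0 ω = 1} with ha
  set b := pr μ {ω | S1 ω = 1} with hb
  have hapos : 0 < a := lt_of_lt_of_le hAT (hprm _ _ fun ω h => h.1)
  have hbpos : 0 < b := lt_of_lt_of_le hAT (hprm _ _ fun ω h => h.2)
  rw [hc0] at hα0
  rw [hc0, hc1] at hq0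
  have hq0pos : 0 < q0 := by rw [hq0]; positivity
  have hp0 : 0 < ϑ * q0 := by
    refine mul_pos ?_ hq0pos
    rw [hϑ]; exact lt_max_of_lt_left hϑL.1
  have hp1 : ϑ * q0 ≤ 1 := by
    rw [← le_div_iff₀ hq0pos, hϑ]
    refine max_le ?_ ?_
    · refine hSM1.trans ?_
      rw [cpr, ← ha, hq0, one_div_div]
      have : pr μ ({ω | S0 ω = 1} ∩ {ω | S1 ω = 1}) ≤ b := hprm _ _ inter_subset_right
      gcongr
    · rw [hϑF]
      have : 1 ≤ 1 / α0 := by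
        rw [hα0, le_div_iff₀ hapos, one_mul]; exact hprle _
      linarith
  obtain ⟨hL, hU⟩ := real_line ν hi F1 yq f1 hF hyq hF1cont hF1mono hf1 (ϑ * q0) hp0 hp1
    htailL htailU
  have hF0 : ∀ t, 0 < ν.real (Iic t) := by
    intro t
    have : ν.real (Iic (t - 1)) < ν.real (Iic t) := by
      rw [← hF, ← hF]; exact hF1mono (by linarith)
    exact lt_of_le_of_lt measureReal_nonneg this
  have hF1' : ∀ t, 0 < ν.real (Ici t) := by
    intro t
    have h1 : ν.real (Iic t) < ν.real (Iic (t + 1)) := by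
      rw [← hF, ← hF]; exact hF1mono (by linarith)
    have h2 : ν.real (Iic (t + 1)) ≤ 1 := measureReal_le_one
    have h3 : ν.real (Iic t)ᶜ = 1 - ν.real (Iic t) := probReal_compl_eq_one_sub measurableSet_Iic
    have h4 : ν.real (Iic t)ᶜ ≤ ν.real (Ici t) :=
      measureReal_mono (fun x hx => by simp at hx ⊢; exact hx.le)
    linarith
  have g1 : {ω | D ω = 1 ∧ S ω = 1 ∧ Y ω ≤ yq (ϑ * q0)} = A ∩ Y ⁻¹' (Iic (yq (ϑ * q0))) := by
    ext ω; simp [hA, and_assoc]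
  have g2 : {ω | D ω = 1 ∧ S ω = 1 ∧ yq (1 - ϑ * q0) ≤ Y ω}
      = A ∩ Y ⁻¹' (Ici (yq (1 - ϑ * q0))) := by
    ext ω; simp [hA, and_assoc]
  rw [g1, g2, hce _ measurableSet_Iic, hce _ measurableSet_Ici]
  constructor
  · exact sub_le_sub_right ((div_le_iff₀ (hF0 _)).mpr hL) _
  · exact sub_le_sub_right ((le_div_iff₀ (hF1' _)).mpr hU) _

end
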